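/- For every k ≥ 1 and u ∈ ℂ, one has h_k(u−k+1) = trace(S_k * T_1(u) * T_2(u−1) * ⋯ * T_k(u−k+1)), i.e. the symmetrized product with decreasing shifts of the spectral parameter computes the homogeneous symmetric function at the shifted argument u−k+1. -/

import Mathlib

/-- Matrices in the `k`-leg model over `A`: square matrices indexed by functions
`Fin k → Fin n`, a model of `End((ℂ^n)^⊗k) ⊗ A`. -/
abbrev LegMatrix (n k : ℕ) (A : Type*) := Matrix (Fin k → Fin n) (Fin k → Fin n) A

variable {n : ℕ} {A : Type*} [Ring A] [Algebra ℂ A]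

/-- `T_s(v)`: the generating matrix `T(v)` placed on leg `s` of the `k`-leg model. -/
def Tleg (T : ℂ → Matrix (Fin n) (Fin n) A) {k : ℕ} (s : Fin k) (v : ℂ) :
    LegMatrix n k A := fun f g =>
  if ∀ t : Fin k, t ≠ s → f t = g t then T v (f s) (g s) else 0

/-- The permutation matrix `P_σ` of a permutation `σ` of the legs:
its `(f,g)`-entry is `1` (via `algebraMap ℂ A`) if `f = g ∘ σ` and `0` otherwise. -/
def Pleg (n : ℕ) (A : Type*) [Ring A] [Algebra ℂ A] {k : ℕ} (σ : Equiv.Perm (Fin k)) :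
    LegMatrix n k A := fun f g => if f = g ∘ σ then algebraMap ℂ A 1 else 0

/-- The transposition of legs with 1-based labels `i`, `j` (identity if out of range;
all uses are in range). -/
def legSwap (k i j : ℕ) : Equiv.Perm (Fin k) :=
  if h : 1 ≤ i ∧ i ≤ k ∧ 1 ≤ j ∧ j ≤ k then
    Equiv.swap ⟨i - 1, by omega⟩ ⟨j - 1, by omega⟩ else 1

/-- The antisymmetrizer `A_k = (1/k!) • Σ_σ sgn(σ) • P_σ` in the `k`-leg model. -/
noncomputable def Aleg (n : ℕ) (A : Type*) [Ring A] [Algebra ℂ A] (k : ℕ) :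
    LegMatrix n k A :=
  ((k.factorial : ℂ))⁻¹ •
    ∑ σ : Equiv.Perm (Fin k), ((Equiv.Perm.sign σ : ℤ) : ℂ) • Pleg n A σ

/-- The symmetrizer `S_k = (1/k!) • Σ_σ P_σ` in the `k`-leg model. -/
noncomputable def Sleg (n : ℕ) (A : Type*) [Ring A] [Algebra ℂ A] (k : ℕ) :
    LegMatrix n k A :=
  ((k.factorial : ℂ))⁻¹ • ∑ σ : Equiv.Perm (Fin k), Pleg n A σ

/-- The ordered product `T_1(u) * T_2(u+d) * ⋯ * T_k(u+(k−1)d)` in the `k`-leg model. -/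
noncomputable def TT (T : ℂ → Matrix (Fin n) (Fin n) A) (k : ℕ) (u d : ℂ) :
    LegMatrix n k A :=
  ((List.finRange k).map (fun s => Tleg T s (u + d * ((s : ℕ) : ℂ)))).prod

/-- The RTT relation of the Yangian of `gl_n`:
`((u−v) • 1 − P_{1,2}) T_1(u) T_2(v) = T_2(v) T_1(u) ((u−v) • 1 − P_{1,2})`
in the 2-leg model. -/
def RTT (T : ℂ → Matrix (Fin n) (Fin n) A) : Prop :=
  ∀ u v : ℂ,
    ((u - v) • (1 : LegMatrix n 2 A) - Pleg n A (legSwap 2 1 2)) *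
        Tleg T (0 : Fin 2) u * Tleg T (1 : Fin 2) v =
      Tleg T (1 : Fin 2) v * Tleg T (0 : Fin 2) u *
        ((u - v) • (1 : LegMatrix n 2 A) - Pleg n A (legSwap 2 1 2))

/-- The elementary symmetric function
`e_k(u) = trace(A_k * T_1(u) * T_2(u−1) * ⋯ * T_k(u−k+1))`; for `k = 0` this is `1`. -/
noncomputable def esym (T : ℂ → Matrix (Fin n) (Fin n) A) (k : ℕ) (u : ℂ) : A :=
  Matrix.trace (Aleg n A k * TT T k u (-1))

/-- The homogeneous symmetric function
`h_k(u) = trace(S_k * T_1(u) * T_2(u+1) * ⋯ * T_k(u+k−1))`; for `k = 0` this is `1`. -/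
noncomputable def hsym (T : ℂ → Matrix (Fin n) (Fin n) A) (k : ℕ) (u : ℂ) : A :=
  Matrix.trace (Sleg n A k * TT T k u 1)

/-- The power sum `p⁻_k(u) = trace(T(u) * T(u−1) * ⋯ * T(u−k+1))`,
an ordinary product of `n×n` matrices over `A`. -/
noncomputable def pminus (T : ℂ → Matrix (Fin n) (Fin n) A) (k : ℕ) (u : ℂ) : A :=
  Matrix.trace (((List.finRange k).map (fun i => T (u - ((i : ℕ) : ℂ)))).prod)

/-- The power sum `p⁺_k(u) = trace(T(u) * T(u+1) * ⋯ * T(u+k−1))`,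
an ordinary product of `n×n` matrices over `A`. -/
noncomputable def pplus (T : ℂ → Matrix (Fin n) (Fin n) A) (k : ℕ) (u : ℂ) : A :=
  Matrix.trace (((List.finRange k).map (fun i => T (u + ((i : ℕ) : ℂ)))).prod)

/-- Left multiplication by `P_σ` permutes the row index. -/
theorem Pleg_mul_apply {k : ℕ} (σ : Equiv.Perm (Fin k)) (M : LegMatrix n k A)
    (f g : Fin k → Fin n) : (Pleg n A σ * M) f g = M (f ∘ σ.symm) g := by
  rw [Matrix.mul_apply, Finset.sum_eq_single (f ∘ σ.symm)]
  · simp [Pleg, Function.comp_assoc]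
  · intro h _ hh
    have : f ≠ h ∘ σ := fun e => hh (by rw [e]; simp [Function.comp_assoc])
    simp [Pleg, this]
  · simp

/-- Right multiplication by `P_σ` permutes the column index. -/
theorem mul_Pleg_apply {k : ℕ} (σ : Equiv.Perm (Fin k)) (M : LegMatrix n k A)
    (f g : Fin k → Fin n) : (M * Pleg n A σ) f g = M f (g ∘ σ) := by
  rw [Matrix.mul_apply, Finset.sum_eq_single (g ∘ σ)]
  · simp [Pleg]
  · intro h _ hh
    simp [Pleg, hh]
  · simp

theorem Pleg_mul_Pleg {k : ℕ} (σ τ : Equiv.Perm (Fin k)) :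
    Pleg n A σ * Pleg n A τ = Pleg n A (τ * σ) := by
  ext f g
  rw [mul_Pleg_apply]
  simp only [Pleg, Equiv.Perm.coe_mul, Function.comp_assoc]
  congr

theorem Sleg_mul_Pleg {k : ℕ} (σ : Equiv.Perm (Fin k)) :
    Sleg n A k * Pleg n A σ = Sleg n A k := by
  simp only [Sleg, Matrix.smul_mul, Finset.sum_mul, Pleg_mul_Pleg]
  congr 1
  exact Fintype.sum_equiv (Equiv.mulLeft σ) _ _ fun _ => rfl

theorem Pleg_mul_Sleg {k : ℕ} (σ : Equiv.Perm (Fin k)) :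
    Pleg n A σ * Sleg n A k = Sleg n A k := by
  simp only [Sleg, Matrix.mul_smul, Finset.mul_sum, Pleg_mul_Pleg]
  congr 1
  exact Fintype.sum_equiv (Equiv.mulRight σ) _ _ fun _ => rfl

theorem Sleg_mul_Sleg (k : ℕ) : Sleg n A k * Sleg n A k = Sleg n A k := by
  conv_lhs => enter [2]; rw [Sleg]
  rw [Matrix.mul_smul, Finset.mul_sum]
  simp only [Sleg_mul_Pleg, Finset.sum_const, Finset.card_univ, Fintype.card_perm,
    Fintype.card_fin]
  rw [← Nat.cast_smul_eq_nsmul ℂ, smul_smul, inv_mul_cancel₀, one_smul]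
  exact_mod_cast k.factorial_ne_zero

/-- Permutation matrices have central entries, so they can be cycled in a trace. -/
theorem trace_Pleg_mul_comm {k : ℕ} (σ : Equiv.Perm (Fin k)) (M : LegMatrix n k A) :
    (Pleg n A σ * M).trace = (M * Pleg n A σ).trace := by
  simp only [Matrix.trace, Matrix.diag_apply, Pleg_mul_apply, mul_Pleg_apply]
  refine Fintype.sum_equiv (σ.arrowCongr (Equiv.refl (Fin n))) _ _ fun f => ?_
  have h : (σ.arrowCongr (Equiv.refl (Fin n))) f = f ∘ σ.symm := rfl
  rw [h]
  simp [Function.comp_assoc]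

theorem trace_Sleg_mul_comm {k : ℕ} (M : LegMatrix n k A) :
    (Sleg n A k * M).trace = (M * Sleg n A k).trace := by
  simp only [Sleg, Matrix.smul_mul, Matrix.mul_smul, Finset.sum_mul, Finset.mul_sum,
    Matrix.trace_smul, Matrix.trace_sum, trace_Pleg_mul_comm]

theorem trace_Sleg_mul_eq {k : ℕ} (M : LegMatrix n k A) :
    (Sleg n A k * M).trace = (Sleg n A k * M * Sleg n A k).trace := by
  rw [← trace_Sleg_mul_comm, ← Matrix.mul_assoc, Sleg_mul_Sleg]

theorem Pleg_mul_Tleg (T : ℂ → Matrix (Fin n) (Fin n) A) {k : ℕ}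
    (σ : Equiv.Perm (Fin k)) (s : Fin k) (v : ℂ) :
    Pleg n A σ * Tleg T (σ s) v = Tleg T s v * Pleg n A σ := by
  ext f g
  rw [Pleg_mul_apply, mul_Pleg_apply]
  simp only [Tleg, Function.comp_apply, Equiv.symm_apply_apply]
  congr 1
  refine propext ⟨fun h t ht => ?_, fun h t ht => ?_⟩
  · simpa using h (σ t) (by simpa using ht)
  · simpa using h (σ.symm t) (fun e => ht (by simp [← e]))

theorem Tleg_mul_Tleg_apply {B : Type*} [Ring B] (T : ℂ → Matrix (Fin n) (Fin n) B) {k : ℕ}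
    {i j : Fin k} (hij : i ≠ j) (u v : ℂ) (f g : Fin k → Fin n) :
    (Tleg T i u * Tleg T j v) f g =
      if ∀ t, t ≠ i → t ≠ j → f t = g t then T u (f i) (g i) * T v (f j) (g j) else 0 := by
  rw [Matrix.mul_apply, Finset.sum_eq_single (Function.update f i (g i))]
  · have h₁ : ∀ t, t ≠ i → f t = Function.update f i (g i) t := fun t ht => by simp [ht]
    have h₂ : (∀ t, t ≠ j → Function.update f i (g i) t = g t) ↔
        ∀ t, t ≠ i → t ≠ j → f t = g t := by
      refine ⟨fun h t hi hj => by simpa [hi] using h t hj, fun h t hj => ?_⟩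
      by_cases hi : t = i
      · simp [hi]
      · simpa [hi] using h t hi hj
    simp only [Tleg, if_pos h₁, h₂, Function.update_self, Function.update_of_ne hij.symm,
      mul_ite, mul_zero]
  · intro h _ hh
    by_cases h₁ : ∀ t, t ≠ i → f t = h t
    · have h₂ : ¬ ∀ t, t ≠ j → h t = g t := fun h₂ => hh <| by
        funext t
        by_cases hi : t = i
        · subst hi; simp [h₂ _ hij]
        · simp [hi, h₁ t hi]
      simp only [Tleg, if_neg h₂, mul_zero]
    · simp only [Tleg, if_neg h₁, zero_mul]
  · simp

/-- The RTT relation in terms of the matrix entries of `T`. -/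
theorem RTT.entries {T : ℂ → Matrix (Fin n) (Fin n) A} (hT : RTT T) (u v : ℂ)
    (a b c d : Fin n) :
    (u - v) • (T u a b * T v c d) - T u c b * T v a d =
      (u - v) • (T v c d * T u a b) - T v c b * T u a d := by
  have h := congrFun (congrFun (hT u v) ![a, c]) ![b, d]
  have hs : legSwap 2 1 2 = Equiv.swap (0 : Fin 2) 1 := by simp [legSwap]
  rw [hs] at h
  rw [mul_assoc, sub_mul, mul_sub, Matrix.smul_mul, Matrix.mul_smul, one_mul, mul_one] at h
  simpa [Pleg_mul_apply, mul_Pleg_apply, Tleg_mul_Tleg_apply, Fin.forall_fin_two] using h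

/-- The RTT relation on an arbitrary pair of distinct legs. -/
theorem RTT.legs {T : ℂ → Matrix (Fin n) (Fin n) A} (hT : RTT T) {k : ℕ} {i j : Fin k}
    (hij : i ≠ j) (u v : ℂ) :
    (u - v) • (Tleg T i u * Tleg T j v) -
        Pleg n A (Equiv.swap i j) * (Tleg T i u * Tleg T j v) =
      (u - v) • (Tleg T j v * Tleg T i u) -
        Tleg T j v * Tleg T i u * Pleg n A (Equiv.swap i j) := by
  ext f g
  have hl : (∀ t, t ≠ i → t ≠ j → (f ∘ (Equiv.swap i j).symm) t = g t) ↔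
      ∀ t, t ≠ i → t ≠ j → f t = g t := by
    refine forall_congr' fun t => forall_congr' fun hi => forall_congr' fun hj => ?_
    simp [Equiv.swap_apply_of_ne_of_ne hi hj]
  have hr : (∀ t, t ≠ j → t ≠ i → f t = (g ∘ Equiv.swap i j) t) ↔
      ∀ t, t ≠ i → t ≠ j → f t = g t := by
    refine forall_congr' fun t => ⟨fun h hi hj => ?_, fun h hj hi => ?_⟩
    · simpa [Equiv.swap_apply_of_ne_of_ne hi hj] using h hj hi
    · simpa [Equiv.swap_apply_of_ne_of_ne hi hj] using h hi hj
  have hc : (∀ t, t ≠ j → t ≠ i → f t = g t) ↔ ∀ t, t ≠ i → t ≠ j → f t = g t :=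
    forall_congr' fun t => ⟨fun h hi hj => h hj hi, fun h hj hi => h hi hj⟩
  simp only [Matrix.sub_apply, Matrix.smul_apply, Pleg_mul_apply, mul_Pleg_apply,
    Tleg_mul_Tleg_apply T hij, Tleg_mul_Tleg_apply T hij.symm, hl, hr, hc]
  split_ifs
  · simpa using hT.entries u v (f i) (g i) (f j) (g j)
  · simp

/-- Permutation matrices act on a product of `T`'s by relabelling its legs. -/
theorem Pleg_mul_prod_Tleg (T : ℂ → Matrix (Fin n) (Fin n) A) {k : ℕ}
    (σ : Equiv.Perm (Fin k)) (a : Fin k → ℂ) (l : List (Fin k)) :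
    Pleg n A σ * (l.map fun s => Tleg T (σ s) (a s)).prod =
      (l.map fun s => Tleg T s (a s)).prod * Pleg n A σ := by
  induction l with
  | nil => simp
  | cons s l ih =>
    simp only [List.map_cons, List.prod_cons]
    rw [← mul_assoc, Pleg_mul_Tleg, mul_assoc, ih, mul_assoc]

theorem Pleg_swap_commute_prod_Tleg (T : ℂ → Matrix (Fin n) (Fin n) A) {k : ℕ}
    {i j : Fin k} (a : Fin k → ℂ) {l : List (Fin k)} (hi : i ∉ l) (hj : j ∉ l) :
    Pleg n A (Equiv.swap i j) * (l.map fun s => Tleg T s (a s)).prod =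
      (l.map fun s => Tleg T s (a s)).prod * Pleg n A (Equiv.swap i j) := by
  rw [← Pleg_mul_prod_Tleg]
  congr 2
  refine List.map_congr_left fun s hs => ?_
  rw [Equiv.swap_apply_of_ne_of_ne (ne_of_mem_of_not_mem hs hi) (ne_of_mem_of_not_mem hs hj)]

/-- Between two symmetrizers, neighbouring `T`'s commute. -/
theorem RTT.Sleg_mul_swap_mul_Sleg {T : ℂ → Matrix (Fin n) (Fin n) A} (hT : RTT T) {k : ℕ}
    {i j : Fin k} (hij : i ≠ j) (u v : ℂ) {X Y : LegMatrix n k A}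
    (hX : Pleg n A (Equiv.swap i j) * X = X * Pleg n A (Equiv.swap i j))
    (hY : Pleg n A (Equiv.swap i j) * Y = Y * Pleg n A (Equiv.swap i j)) :
    Sleg n A k * (X * (Tleg T i u * Tleg T j v) * Y) * Sleg n A k =
      Sleg n A k * (X * (Tleg T j v * Tleg T i u) * Y) * Sleg n A k := by
  wlog hc : u - v ≠ 1 generalizing i j u v
  · rw [Equiv.swap_comm] at hX hY
    refine (this hij.symm v u hX hY fun h => ?_).symm
    rw [not_not] at hc
    have : (2 : ℂ) = 0 := by linear_combination -hc - h
    norm_num at this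
  have hSX : Sleg n A k * X * Pleg n A (Equiv.swap i j) = Sleg n A k * X := by
    rw [mul_assoc, ← hX, ← mul_assoc, Sleg_mul_Pleg]
  have hYS : Pleg n A (Equiv.swap i j) * (Y * Sleg n A k) = Y * Sleg n A k := by
    rw [← mul_assoc, hY, mul_assoc, Pleg_mul_Sleg]
  have h := congrArg (fun M => Sleg n A k * X * M * (Y * Sleg n A k)) (hT.legs hij u v)
  simp only [mul_sub, sub_mul, Matrix.mul_smul, Matrix.smul_mul] at h
  rw [← mul_assoc (Sleg n A k * X) (Pleg n A _), hSX, ← mul_assoc (Sleg n A k * X) _ (Pleg n A _),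
    mul_assoc _ (Pleg n A _), hYS] at h
  simp only [mul_assoc] at h ⊢
  refine smul_right_injective _ (sub_ne_zero.mpr hc) ?_
  simpa only [sub_smul, one_smul] using h

/-- Between two symmetrizers, the order of the factors `T_s` is irrelevant. -/
theorem RTT.Sleg_mul_prod_mul_Sleg_perm {T : ℂ → Matrix (Fin n) (Fin n) A} (hT : RTT T) {k : ℕ}
    (a : Fin k → ℂ) {l l' : List (Fin k)} (hl : l.Perm l') (p : List (Fin k))
    (hp : (p ++ l).Nodup) :
    Sleg n A k * ((p ++ l).map fun s => Tleg T s (a s)).prod * Sleg n A k =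
      Sleg n A k * ((p ++ l').map fun s => Tleg T s (a s)).prod * Sleg n A k := by
  induction hl generalizing p with
  | nil => rfl
  | cons x _ ih => simpa using ih (p ++ [x]) (by simpa using hp)
  | swap x y l =>
    simp only [List.nodup_append, List.nodup_cons, List.mem_cons, not_or] at hp
    obtain ⟨-, ⟨⟨hyx, hyl⟩, hxl, -⟩, hpl⟩ := hp
    have hyp : y ∉ p := fun h => hpl y h y (Or.inl rfl) rfl
    have hxp : x ∉ p := fun h => hpl x h x (Or.inr (Or.inl rfl)) rfl
    have := hT.Sleg_mul_swap_mul_Sleg hyx (a y) (a x)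
      (Pleg_swap_commute_prod_Tleg T a hyp hxp) (Pleg_swap_commute_prod_Tleg T a hyl hxl)
    simpa only [List.map_append, List.map_cons, List.prod_append, List.prod_cons,
      mul_assoc] using this
  | trans h₁ _ ih₁ ih₂ =>
    exact (ih₁ p hp).trans (ih₂ p ((h₁.append_left p).nodup_iff.mp hp))

/-- `h_k(u−k+1) = trace(S_k T_1(u) T_2(u−1) ⋯ T_k(u−k+1))`. -/
theorem hsym_shifted_eq (hn : 1 ≤ n) (T : ℂ → Matrix (Fin n) (Fin n) A)
    (hT : RTT T) (k : ℕ) (hk : 1 ≤ k) (u : ℂ) :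
    hsym T k (u - (k : ℂ) + 1) = Matrix.trace (Sleg n A k * TT T k u (-1)) := by
  rw [hsym, TT, TT, trace_Sleg_mul_eq, trace_Sleg_mul_eq]
  congr 1
  have hrev := Pleg_mul_prod_Tleg T Fin.revPerm (fun s : Fin k => u + -1 * ((s : ℕ) : ℂ))
    (List.finRange k)
  have hperm : (List.finRange k).Perm ((List.finRange k).map Fin.revPerm) :=
    (List.perm_ext_iff_of_nodup (List.nodup_finRange k)
      ((List.nodup_finRange k).map Fin.revPerm.injective)).mpr fun s => by
        simpa using ⟨s.rev, s.rev_rev⟩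
  have h := hT.Sleg_mul_prod_mul_Sleg_perm
    (fun s : Fin k => u - (k : ℂ) + 1 + 1 * ((s : ℕ) : ℂ)) hperm [] (List.nodup_finRange k)
  simp only [List.nil_append, List.map_map] at h
  have hmap : (fun s : Fin k => Tleg T s (u - (k : ℂ) + 1 + 1 * ((s : ℕ) : ℂ))) ∘ Fin.revPerm =
      fun s : Fin k => Tleg T (Fin.revPerm s) (u + -1 * ((s : ℕ) : ℂ)) := by
    funext s
    have hs : ((s.rev : ℕ) : ℂ) = k - (s + 1) := by
      rw [Fin.val_rev, Nat.cast_sub s.isLt]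
      push_cast
      ring
    simp only [Function.comp_apply, Fin.revPerm_apply, hs]
    congr 1
    ring
  have hS := congrArg (fun M => Sleg n A k * M * Sleg n A k) hrev
  simp only [← mul_assoc, Sleg_mul_Pleg] at hS
  rw [h, hmap, hS, mul_assoc _ (Pleg n A _), Pleg_mul_Sleg]
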